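/- It holds that Σ_{i,j=1}^n ∫_{S^{n-1}} H_{ij}(x̄)² dS = (1/(2(n+2))) Σ_{i,j,k=1}^n ∫_{S^{n-1}} (∂_k H_{ij}(x̄))² dS = (|S^{n-1}|/(2n(n+2))) |W|². -/

import Mathlib

open MeasureTheory Real Filter Topology

noncomputable section

/-- The tensor `H_{ij}(x̄) = Σ_{k,l} W_{ikjl} x^k x^l`. -/
def Hten (n : ℕ) (W4 : Fin n → Fin n → Fin n → Fin n → ℝ) (i j : Fin n)
    (x : EuclideanSpace ℝ (Fin n)) : ℝ :=
  ∑ k, ∑ l, W4 i k j l * x k * x l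

/-- The squared tensor norm `|W|² = Σ (W_{ikjl} + W_{iljk})²`. -/
def normWsq (n : ℕ) (W4 : Fin n → Fin n → Fin n → Fin n → ℝ) : ℝ :=
  ∑ i, ∑ j, ∑ k, ∑ l, (W4 i k j l + W4 i l j k) ^ 2

/-- The symmetric two-tensor `W̃_{ij} = Σ_{k,p,q}(W_{ikpq}+W_{kqip})(W_{jkpq}+W_{kqjp})`. -/
def Wtil (n : ℕ) (W4 : Fin n → Fin n → Fin n → Fin n → ℝ) (i j : Fin n) : ℝ :=
  ∑ k, ∑ p, ∑ q, (W4 i k p q + W4 k q i p) * (W4 j k p q + W4 k q j p)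

/-- The partial derivative `∂_k f`. -/
def pd (n : ℕ) (k : Fin n) (f : EuclideanSpace ℝ (Fin n) → ℝ) :
    EuclideanSpace ℝ (Fin n) → ℝ :=
  fun x => fderiv ℝ f x (EuclideanSpace.single k 1)

/-- The Euclidean Laplacian `Δf = Σ_k ∂_k∂_k f`. -/
def lapl (n : ℕ) (f : EuclideanSpace ℝ (Fin n) → ℝ) :
    EuclideanSpace ℝ (Fin n) → ℝ :=
  fun x => ∑ k, pd n k (pd n k f) x

/-- The tensor `h̄_{ij}(x̄) = f(|x̄|²) H_{ij}(x̄)`. -/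
def hbar (n : ℕ) (W4 : Fin n → Fin n → Fin n → Fin n → ℝ) (f : Polynomial ℝ)
    (i j : Fin n) (x : EuclideanSpace ℝ (Fin n)) : ℝ :=
  Polynomial.eval (‖x‖ ^ 2) f * Hten n W4 i j x

open scoped ENNReal RealInnerProductSpace

/-- The Hausdorff measure of dimension `n - 1` is finite on the unit sphere of `ℝⁿ`: the sphere is
covered by the radial projections of the faces of a cube. -/
lemma hausdorffMeasure_sphere_lt_top {n : ℕ} (hn : 1 ≤ n) :
    μH[(n : ℝ) - 1] (Metric.sphere (0 : EuclideanSpace ℝ (Fin n)) 1) < ∞ := by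
  have : NeZero n := ⟨by omega⟩
  let p : (i : Fin n) → ℝ → ({j : Fin n // j ≠ i} → ℝ) → EuclideanSpace ℝ (Fin n) :=
    fun i s y => WithLp.toLp 2 fun j => if h : j ≠ i then y ⟨j, h⟩ else s
  let cube : (i : Fin n) → Set ({j : Fin n // j ≠ i} → ℝ) := fun i => Set.Icc (-1) 1
  have hcover : Metric.sphere (0 : EuclideanSpace ℝ (Fin n)) 1 ⊆
      ⋃ i, ⋃ s ∈ ({1, -1} : Finset ℝ), (fun y => ‖p i s y‖⁻¹ • p i s y) '' cube i := by
    intro x hx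
    have hx1 : ‖x‖ = 1 := by simpa using hx
    obtain ⟨i, hi⟩ := Finite.exists_max fun i => |x i|
    have hxi : x i ≠ 0 := by
      intro h
      have hx0 : x = 0 := by
        ext j
        simpa [h] using hi j
      simp [hx0] at hx1
    have hpos : 0 < |x i| := abs_pos.2 hxi
    simp only [Set.mem_iUnion]
    have hp : p i (x i / |x i|) (fun j => x j / |x i|) = |x i|⁻¹ • x := by
      ext j
      by_cases h : j = i
      · subst h
        simp [p, div_eq_inv_mul]
      · simp [p, h, div_eq_inv_mul]
    refine ⟨i, x i / |x i|, ?_, fun j => x j / |x i|, ?_, ?_⟩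
    · rcases lt_or_gt_of_ne hxi with h | h
      · simp [abs_of_neg h, hxi]
      · simp [abs_of_pos h, hxi]
    · have h1 : ∀ j, abs (x j / |x i|) ≤ 1 := fun j => by
        rw [abs_div, abs_abs]
        exact div_le_one_of_le₀ (hi j) hpos.le
      exact ⟨fun j => (abs_le.1 (h1 j)).1, fun j => (abs_le.1 (h1 j)).2⟩
    · simp only [hp, norm_smul, hx1, norm_inv, norm_abs_eq_norm]
      rw [smul_smul]
      simp [hxi]
  refine (measure_mono hcover).trans_lt ?_
  refine (measure_iUnion_le _).trans_lt ?_
  rw [tsum_fintype]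
  refine ENNReal.sum_lt_top.2 fun i _ => ?_
  refine measure_biUnion_lt_top (Finset.finite_toSet _) fun s hs => ?_
  have hs0 : s ≠ 0 := by
    rintro rfl
    simp at hs
  have hp0 : ∀ y, p i s y ≠ 0 := fun y h => hs0 <| by
    have := congrArg (fun v : EuclideanSpace ℝ (Fin n) => v i) h
    simpa [p] using this
  have hpd : ContDiff ℝ 1 (p i s) := by
    rw [contDiff_euclidean]
    intro j
    by_cases h : j = i
    · simp only [p, h, ne_eq, not_true_eq_false, dite_false]
      exact contDiff_const
    · simp only [p, h, ne_eq, not_false_eq_true, dite_true]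
      exact contDiff_apply ℝ ℝ _
  have hgd : ContDiff ℝ 1 fun y => ‖p i s y‖⁻¹ • p i s y :=
    ((hpd.norm ℝ hp0).inv fun y => norm_ne_zero_iff.2 (hp0 y)).smul hpd
  obtain ⟨K, hK⟩ := hgd.contDiffOn.exists_lipschitzOnWith (s := cube i) one_ne_zero
    (convex_Icc _ _) isCompact_Icc
  have hcard : (n : ℝ) - 1 = Fintype.card {j : Fin n // j ≠ i} := by
    simp [Fintype.card_subtype_compl, Nat.cast_sub hn]
  rw [hcard]
  refine (hK.hausdorffMeasure_image_le (Nat.cast_nonneg _)).trans_lt ?_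
  rw [hausdorffMeasure_pi_real]
  exact ENNReal.mul_lt_top (ENNReal.rpow_lt_top_of_nonneg (Nat.cast_nonneg _) (by simp))
    isCompact_Icc.measure_lt_top

lemma Continuous.integrableOn_sphere {n : ℕ} (hn : 1 ≤ n) {f : EuclideanSpace ℝ (Fin n) → ℝ}
    (hf : Continuous f) :
    IntegrableOn f (Metric.sphere 0 1) μH[(n : ℝ) - 1] := by
  obtain ⟨C, hC⟩ := (isCompact_sphere (0 : EuclideanSpace ℝ (Fin n)) 1).exists_bound_of_continuousOn
    hf.continuousOn
  refine Measure.integrableOn_of_bounded (M := C) (hausdorffMeasure_sphere_lt_top hn).ne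
    hf.aestronglyMeasurable ?_
  exact ae_restrict_of_forall_mem Metric.isClosed_sphere.measurableSet hC

lemma setIntegral_sphere_comp_linearIsometryEquiv {n : ℕ}
    (e : EuclideanSpace ℝ (Fin n) ≃ₗᵢ[ℝ] EuclideanSpace ℝ (Fin n))
    (f : EuclideanSpace ℝ (Fin n) → ℝ) (d : ℝ) :
    ∫ x in Metric.sphere 0 1, f (e x) ∂μH[d] = ∫ x in Metric.sphere 0 1, f x ∂μH[d] := by
  have h := (e.toIsometryEquiv.measurePreserving_hausdorffMeasure d).setIntegral_preimage_emb
    e.toIsometryEquiv.toHomeomorph.measurableEmbedding f (Metric.sphere 0 1)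
  have hs : e.toIsometryEquiv ⁻¹' Metric.sphere (0 : EuclideanSpace ℝ (Fin n)) 1 =
      Metric.sphere 0 1 := by
    ext x
    simp
  rw [hs] at h
  exact h

/-- By rotation invariance, the fourth moment of the sphere in the direction `v` is proportional
to `‖v‖⁴`. -/
lemma exists_setIntegral_sphere_inner_pow_four {n : ℕ} (hn : 1 ≤ n) (d : ℝ) :
    ∃ c : ℝ, ∀ v : EuclideanSpace ℝ (Fin n),
      ∫ x in Metric.sphere 0 1, ⟪v, x⟫ ^ 4 ∂μH[d] = c * ⟪v, v⟫ ^ 2 := by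
  let e : EuclideanSpace ℝ (Fin n) := EuclideanSpace.single ⟨0, hn⟩ 1
  refine ⟨∫ x in Metric.sphere 0 1, ⟪e, x⟫ ^ 4 ∂μH[d], fun v => ?_⟩
  have hnorm : ‖v‖ = ‖‖v‖ • e‖ := by simp [norm_smul, e]
  let R := (ℝ ∙ (v - ‖v‖ • e))ᗮ.reflection
  have hR : R v = ‖v‖ • e := Submodule.reflection_sub hnorm
  rw [← setIntegral_sphere_comp_linearIsometryEquiv R.symm, mul_comm, ← integral_const_mul]
  congr 1 with x
  rw [← R.inner_map_map, hR, R.apply_symm_apply, real_inner_smul_left,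
    real_inner_self_eq_norm_sq]
  ring

/-- Fourth moments of the sphere, by polarization. -/
lemma exists_setIntegral_sphere_inner_mul {n : ℕ} (hn : 1 ≤ n) :
    ∃ B : ℝ, ∀ a b c d : EuclideanSpace ℝ (Fin n),
      ∫ x in Metric.sphere 0 1, ⟪a, x⟫ * ⟪b, x⟫ * ⟪c, x⟫ * ⟪d, x⟫ ∂μH[(n : ℝ) - 1] =
        B * (⟪a, b⟫ * ⟪c, d⟫ + ⟪a, c⟫ * ⟪b, d⟫ + ⟪a, d⟫ * ⟪b, c⟫) := by
  obtain ⟨C, hC⟩ := exists_setIntegral_sphere_inner_pow_four hn ((n : ℝ) - 1)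
  refine ⟨C / 3, fun a b c d => ?_⟩
  let u : Finset ℝ := {1, -1}
  have hu : ∀ f : ℝ → ℝ, ∑ s ∈ u, f s = f 1 + f (-1) := fun f => by
    rw [Finset.sum_pair (by norm_num)]
  have hpol : ∀ x : EuclideanSpace ℝ (Fin n), ⟪a, x⟫ * ⟪b, x⟫ * ⟪c, x⟫ * ⟪d, x⟫ =
      1 / 192 * ∑ r ∈ u, ∑ s ∈ u, ∑ t ∈ u,
        r * s * t * ⟪a + r • b + s • c + t • d, x⟫ ^ 4 := fun x => by
    simp only [inner_add_left, real_inner_smul_left, hu]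
    ring
  have hint : ∀ w v, IntegrableOn (fun x : EuclideanSpace ℝ (Fin n) => w * ⟪v, x⟫ ^ 4)
      (Metric.sphere 0 1) μH[(n : ℝ) - 1] := fun w v =>
    Continuous.integrableOn_sphere hn (by fun_prop)
  simp_rw [hpol]
  rw [integral_const_mul, integral_finsetSum _ fun r _ => integrable_finsetSum _ fun s _ =>
    integrable_finsetSum _ fun t _ => hint _ _]
  simp_rw [integral_finsetSum u fun s _ => integrable_finsetSum u fun t _ => hint _ _,
    integral_finsetSum u fun t _ => hint _ _, integral_const_mul, hC]
  simp only [inner_add_left, inner_add_right, real_inner_smul_left, real_inner_smul_right, hu,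
    real_inner_comm a, real_inner_comm b c, real_inner_comm b d, real_inner_comm c d]
  ring

lemma sum_sq_eq_one_of_mem_sphere {n : ℕ} {x : EuclideanSpace ℝ (Fin n)}
    (hx : x ∈ Metric.sphere 0 1) : ∑ i, x i * x i = 1 := by
  have h := EuclideanSpace.real_norm_sq_eq x
  rw [mem_sphere_zero_iff_norm.1 hx] at h
  simpa [pow_two] using h.symm

lemma setIntegral_sphere_coord_mul_four {n : ℕ} (hn : 1 ≤ n) (k l p q : Fin n) :
    ∫ x in Metric.sphere (0 : EuclideanSpace ℝ (Fin n)) 1, x k * x l * x p * x q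
        ∂μH[(n : ℝ) - 1] =
      (μH[(n : ℝ) - 1] (Metric.sphere (0 : EuclideanSpace ℝ (Fin n)) 1)).toReal / (n * (n + 2)) *
        ((if k = l then 1 else 0) * (if p = q then 1 else 0) +
          (if k = p then 1 else 0) * (if l = q then 1 else 0) +
          (if k = q then 1 else 0) * (if l = p then 1 else 0)) := by
  obtain ⟨B, hB⟩ := exists_setIntegral_sphere_inner_mul hn
  have hcoord : ∀ k l p q : Fin n,
      ∫ x in Metric.sphere (0 : EuclideanSpace ℝ (Fin n)) 1, x k * x l * x p * x q
        ∂μH[(n : ℝ) - 1] = B *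
        ((if k = l then 1 else 0) * (if p = q then 1 else 0) +
          (if k = p then 1 else 0) * (if l = q then 1 else 0) +
          (if k = q then 1 else 0) * (if l = p then 1 else 0)) := fun k l p q => by
    simpa [EuclideanSpace.inner_single_left, eq_comm] using
      hB (EuclideanSpace.single k 1) (EuclideanSpace.single l 1) (EuclideanSpace.single p 1)
        (EuclideanSpace.single q 1)
  have hn0 : (n : ℝ) ≠ 0 := by positivity
  have htotal : (μH[(n : ℝ) - 1] (Metric.sphere (0 : EuclideanSpace ℝ (Fin n)) 1)).toReal =
      B * (n * (n + 2)) := by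
    calc
      _ = ∫ x in Metric.sphere (0 : EuclideanSpace ℝ (Fin n)) 1, (1 : ℝ) ∂μH[(n : ℝ) - 1] := by
        simp [Measure.real]
      _ = ∫ x in Metric.sphere (0 : EuclideanSpace ℝ (Fin n)) 1,
          ∑ i, ∑ j, x i * x i * x j * x j ∂μH[(n : ℝ) - 1] := by
        refine setIntegral_congr_fun Metric.isClosed_sphere.measurableSet fun x hx => ?_
        simp only [mul_assoc, ← Finset.mul_sum]
        simp [sum_sq_eq_one_of_mem_sphere hx]
      _ = ∑ i, ∑ j, ∫ x in Metric.sphere (0 : EuclideanSpace ℝ (Fin n)) 1,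
          x i * x i * x j * x j ∂μH[(n : ℝ) - 1] := by
        rw [integral_finsetSum _ fun i _ => Continuous.integrableOn_sphere hn (by fun_prop)]
        refine Finset.sum_congr rfl fun i _ => ?_
        rw [integral_finsetSum _ fun j _ => Continuous.integrableOn_sphere hn (by fun_prop)]
      _ = B * (n * (n + 2)) := by
        simp_rw [hcoord, ← Finset.mul_sum, Finset.sum_add_distrib]
        congr 1
        simp
        ring
  rw [hcoord, htotal, mul_div_cancel_right₀ _ (by positivity)]

/-- Integral over the sphere of the square of a quadratic form. -/
lemma setIntegral_sphere_quadratic_sq {n : ℕ} (hn : 1 ≤ n) (A : Fin n → Fin n → ℝ) :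
    ∫ x in Metric.sphere (0 : EuclideanSpace ℝ (Fin n)) 1, (∑ k, ∑ l, A k l * x k * x l) ^ 2
        ∂μH[(n : ℝ) - 1] =
      (μH[(n : ℝ) - 1] (Metric.sphere (0 : EuclideanSpace ℝ (Fin n)) 1)).toReal / (n * (n + 2)) *
        ((∑ k, A k k) ^ 2 + ∑ k, ∑ l, A k l ^ 2 + ∑ k, ∑ l, A k l * A l k) := by
  have hexp : ∀ x : EuclideanSpace ℝ (Fin n), (∑ k, ∑ l, A k l * x k * x l) ^ 2 =
      ∑ k, ∑ l, ∑ p, ∑ q, A k l * A p q * (x k * x l * x p * x q) := fun x => by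
    simp only [pow_two, Finset.sum_mul, Finset.mul_sum]
    exact Finset.sum_congr rfl fun k _ => Finset.sum_congr rfl fun l _ =>
      Finset.sum_congr rfl fun p _ => Finset.sum_congr rfl fun q _ => by ring
  simp_rw [hexp]
  rw [integral_finsetSum _ fun i _ => Continuous.integrableOn_sphere hn (by fun_prop)]
  have hswap : ∀ k l, ∫ x in Metric.sphere (0 : EuclideanSpace ℝ (Fin n)) 1,
      ∑ p, ∑ q, A k l * A p q * (x k * x l * x p * x q) ∂μH[(n : ℝ) - 1] =
      ∑ p, ∑ q, A k l * A p q * ∫ x in Metric.sphere (0 : EuclideanSpace ℝ (Fin n)) 1,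
        x k * x l * x p * x q ∂μH[(n : ℝ) - 1] := fun k l => by
    rw [integral_finsetSum _ fun i _ => Continuous.integrableOn_sphere hn (by fun_prop)]
    refine Finset.sum_congr rfl fun p _ => ?_
    rw [integral_finsetSum _ fun i _ => Continuous.integrableOn_sphere hn (by fun_prop)]
    exact Finset.sum_congr rfl fun q _ => integral_const_mul _ _
  have hswap' : ∀ k, ∫ x in Metric.sphere (0 : EuclideanSpace ℝ (Fin n)) 1,
      ∑ l, ∑ p, ∑ q, A k l * A p q * (x k * x l * x p * x q) ∂μH[(n : ℝ) - 1] =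
      ∑ l, ∫ x in Metric.sphere (0 : EuclideanSpace ℝ (Fin n)) 1,
        ∑ p, ∑ q, A k l * A p q * (x k * x l * x p * x q) ∂μH[(n : ℝ) - 1] := fun k =>
    integral_finsetSum _ fun i _ => Continuous.integrableOn_sphere hn (by fun_prop)
  simp_rw [hswap', hswap, setIntegral_sphere_coord_mul_four hn, mul_left_comm _ (_ / _),
    ← Finset.mul_sum]
  congr 1
  simp only [mul_add, Finset.sum_add_distrib, pow_two]
  simp [Finset.sum_ite_irrel, Finset.sum_mul_sum]

/-- Integral over the sphere of the square of a linear form. -/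
lemma setIntegral_sphere_linear_sq {n : ℕ} (hn : 1 ≤ n) (a : Fin n → ℝ) :
    ∫ x in Metric.sphere (0 : EuclideanSpace ℝ (Fin n)) 1, (∑ l, a l * x l) ^ 2
        ∂μH[(n : ℝ) - 1] =
      (μH[(n : ℝ) - 1] (Metric.sphere (0 : EuclideanSpace ℝ (Fin n)) 1)).toReal / n *
        ∑ l, a l ^ 2 := by
  have hn0 : (n : ℝ) ≠ 0 := by positivity
  have hcoord : ∀ k l : Fin n,
      ∫ x in Metric.sphere (0 : EuclideanSpace ℝ (Fin n)) 1, x k * x l ∂μH[(n : ℝ) - 1] =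
      (μH[(n : ℝ) - 1] (Metric.sphere (0 : EuclideanSpace ℝ (Fin n)) 1)).toReal / n *
        (if k = l then 1 else 0) := fun k l => by
    calc
      _ = ∫ x in Metric.sphere (0 : EuclideanSpace ℝ (Fin n)) 1,
          ∑ j, x k * x l * x j * x j ∂μH[(n : ℝ) - 1] := by
        refine setIntegral_congr_fun Metric.isClosed_sphere.measurableSet fun x hx => ?_
        simp only [mul_assoc, ← Finset.mul_sum, sum_sq_eq_one_of_mem_sphere hx, mul_one]
      _ = _ := by
        rw [integral_finsetSum _ fun i _ => Continuous.integrableOn_sphere hn (by fun_prop)]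
        simp_rw [setIntegral_sphere_coord_mul_four hn, ← Finset.mul_sum, Finset.sum_add_distrib]
        by_cases h : k = l
        · simp [h]
          field_simp
          ring
        · simp [h]
  have hexp : ∀ x : EuclideanSpace ℝ (Fin n), (∑ l, a l * x l) ^ 2 =
      ∑ k, ∑ l, a k * a l * (x k * x l) := fun x => by
    simp only [pow_two, Finset.sum_mul, Finset.mul_sum]
    exact Finset.sum_congr rfl fun k _ => Finset.sum_congr rfl fun l _ => by ring
  simp_rw [hexp]
  rw [integral_finsetSum _ fun i _ => Continuous.integrableOn_sphere hn (by fun_prop)]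
  have hswap : ∀ k, ∫ x in Metric.sphere (0 : EuclideanSpace ℝ (Fin n)) 1,
      ∑ l, a k * a l * (x k * x l) ∂μH[(n : ℝ) - 1] =
      ∑ l, a k * a l * ∫ x in Metric.sphere (0 : EuclideanSpace ℝ (Fin n)) 1,
        x k * x l ∂μH[(n : ℝ) - 1] := fun k => by
    rw [integral_finsetSum _ fun i _ => Continuous.integrableOn_sphere hn (by fun_prop)]
    exact Finset.sum_congr rfl fun q _ => integral_const_mul _ _
  simp_rw [hswap, hcoord, mul_left_comm _ (_ / _), ← Finset.mul_sum]
  simp [pow_two]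

lemma pd_Hten (n : ℕ) (W4 : Fin n → Fin n → Fin n → Fin n → ℝ) (i j k : Fin n)
    (x : EuclideanSpace ℝ (Fin n)) :
    pd n k (Hten n W4 i j) x = ∑ l, (W4 i k j l + W4 i l j k) * x l := by
  have hproj : ∀ p : Fin n, HasFDerivAt (fun y : EuclideanSpace ℝ (Fin n) => y p)
      (EuclideanSpace.proj p : EuclideanSpace ℝ (Fin n) →L[ℝ] ℝ) x := fun p =>
    (EuclideanSpace.proj p : EuclideanSpace ℝ (Fin n) →L[ℝ] ℝ).hasFDerivAt
  have h : HasFDerivAt (Hten n W4 i j) _ x :=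
    HasFDerivAt.fun_sum fun p (_ : p ∈ Finset.univ) =>
      HasFDerivAt.fun_sum fun q (_ : q ∈ Finset.univ) =>
        ((hproj p).const_mul (W4 i p j q)).mul (hproj q)
  rw [pd, h.fderiv]
  simp [Finset.sum_add_distrib, add_mul, mul_comm, add_comm]

theorem stmt_10 (n : ℕ) (hn : 2 ≤ n) (W4 : Fin n → Fin n → Fin n → Fin n → ℝ)
    (hanti1 : ∀ i j k l, W4 i j k l = -W4 j i k l)
    (hanti2 : ∀ i j k l, W4 i j k l = -W4 i j l k)
    (hsymm : ∀ i j k l, W4 i j k l = W4 k l i j)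
    (hbianchi : ∀ i j k l, W4 i j k l + W4 i k l j + W4 i l j k = 0)
    (htrace : ∀ j k, ∑ i, W4 i j i k = 0) :
    (∑ i, ∑ j, ∫ x in Metric.sphere (0 : EuclideanSpace ℝ (Fin n)) 1,
        (Hten n W4 i j x) ^ 2 ∂μH[(n : ℝ) - 1]) =
      (1 / (2 * ((n : ℝ) + 2))) *
        ∑ i, ∑ j, ∑ k, ∫ x in Metric.sphere (0 : EuclideanSpace ℝ (Fin n)) 1,
          (pd n k (Hten n W4 i j) x) ^ 2 ∂μH[(n : ℝ) - 1] ∧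
    (∑ i, ∑ j, ∫ x in Metric.sphere (0 : EuclideanSpace ℝ (Fin n)) 1,
        (Hten n W4 i j x) ^ 2 ∂μH[(n : ℝ) - 1]) =
      (μH[(n : ℝ) - 1] (Metric.sphere (0 : EuclideanSpace ℝ (Fin n)) 1)).toReal /
        (2 * (n : ℝ) * ((n : ℝ) + 2)) * normWsq n W4 := by
  have hn1 : 1 ≤ n := by omega
  have hn0 : (n : ℝ) ≠ 0 := by positivity
  have htr : ∀ i j, ∑ k, W4 i k j k = 0 := fun i j => by
    rw [← htrace i j]
    exact Finset.sum_congr rfl fun k _ => by rw [hanti1, hanti2, neg_neg]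
  have hnorm : normWsq n W4 =
      2 * ∑ i, ∑ j, (∑ k, ∑ l, W4 i k j l ^ 2 + ∑ k, ∑ l, W4 i k j l * W4 i l j k) := by
    rw [normWsq, Finset.mul_sum]
    refine Finset.sum_congr rfl fun i _ => ?_
    rw [Finset.mul_sum]
    refine Finset.sum_congr rfl fun j _ => ?_
    have hcomm : ∑ k, ∑ l, W4 i l j k ^ 2 = ∑ k, ∑ l, W4 i k j l ^ 2 := Finset.sum_comm
    simp_rw [add_sq, Finset.sum_add_distrib, hcomm, mul_assoc, ← Finset.mul_sum]
    ring
  have hH : (∑ i, ∑ j, ∫ x in Metric.sphere (0 : EuclideanSpace ℝ (Fin n)) 1,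
        (Hten n W4 i j x) ^ 2 ∂μH[(n : ℝ) - 1]) =
      (μH[(n : ℝ) - 1] (Metric.sphere (0 : EuclideanSpace ℝ (Fin n)) 1)).toReal /
        (2 * (n : ℝ) * ((n : ℝ) + 2)) * normWsq n W4 := by
    simp_rw [Hten, setIntegral_sphere_quadratic_sq hn1 fun k l => W4 _ k _ l, htr,
      ← Finset.mul_sum, hnorm]
    field_simp
    simp
  refine ⟨?_, hH⟩
  simp_rw [hH, pd_Hten, setIntegral_sphere_linear_sq hn1, ← Finset.mul_sum]
  rw [← normWsq]
  field_simp

end
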